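/- Let $n \ge 3$ and $k \ge 1$. If $n \le 2k+1$ then $\operatorname{depth}(S/I(C_n^k)) = 1$, and if $n \ge 2k+2$ then $\operatorname{depth}(S/I(C_n^k)) \ge \lceil (n-k)/(2k+1) \rceil$. -/

import Mathlib

open MvPolynomial

/-- The edge ideal of the `k`-th power of the path on `n` vertices in
`S = K[x_1,…,x_n]` (the variable `X t` for `t : Fin n` is `x_{t+1}` in 1-based labels):
generated by the `x_i x_j` with `0 < j - i ≤ k`. -/
noncomputable def pathIdeal (K : Type*) [Field K] (n k : ℕ) :
    Ideal (MvPolynomial (Fin n) K) :=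
  Ideal.span {m | ∃ i j : Fin n, (i : ℕ) < j ∧ (j : ℕ) - i ≤ k ∧ m = X i * X j}

/-- The edge ideal of the `k`-th power of the cycle on `n` vertices in `K[x_1,…,x_n]`. -/
noncomputable def cycleIdeal (K : Type*) [Field K] (n k : ℕ) :
    Ideal (MvPolynomial (Fin n) K) :=
  Ideal.span {m | ∃ i j : Fin n, (i : ℕ) < j ∧ ((j : ℕ) - i ≤ k ∨ n - k ≤ (j : ℕ) - i) ∧
    m = X i * X j}

/-- The edge ideal, regarded in `K[x_1,…,x_n]`, of the `k`-th power of the path on the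
consecutive vertices with 1-based labels `a,…,b`. -/
noncomputable def pathIdealOn (K : Type*) [Field K] (n k a b : ℕ) :
    Ideal (MvPolynomial (Fin n) K) :=
  Ideal.span {m | ∃ i j : Fin n, a ≤ (i : ℕ) + 1 ∧ (j : ℕ) + 1 ≤ b ∧ (i : ℕ) < j ∧
    (j : ℕ) - i ≤ k ∧ m = X i * X j}

/-- The monomial prime ideal `(x_a, x_{a+1}, …, x_b)` of `K[x_1,…,x_n]` (1-based labels). -/
noncomputable def varSpan (K : Type*) [Field K] (n a b : ℕ) :
    Ideal (MvPolynomial (Fin n) K) :=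
  Ideal.span {m | ∃ t : Fin n, a ≤ (t : ℕ) + 1 ∧ (t : ℕ) + 1 ≤ b ∧ m = X t}

/-- The depth of `S/I` with respect to the maximal graded ideal `(x_1,…,x_n)`:
the supremum of lengths of (weakly) regular sequences on `S/I` from `(x_1,…,x_n)`. -/
noncomputable def pdepth {K : Type*} [Field K] {n : ℕ} (I : Ideal (MvPolynomial (Fin n) K)) :
    ℕ∞ :=
  sSup {d : ℕ∞ | ∃ rs : List (MvPolynomial (Fin n) K),
    (∀ r ∈ rs, r ∈ Ideal.span (Set.range (X (R := K) (σ := Fin n)))) ∧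
    RingTheory.Sequence.IsWeaklyRegular (MvPolynomial (Fin n) K ⧸ I) rs ∧
    (rs.length : ℕ∞) = d}

/-- The set of exponent vectors of monomials belonging to a (monomial) ideal `I`. -/
def monSet {K : Type*} [Field K] {n : ℕ} (I : Ideal (MvPolynomial (Fin n) K)) :
    Set (Fin n → ℕ) :=
  {a | (∏ i, X i ^ a i : MvPolynomial (Fin n) K) ∈ I}

/-- The set of exponent vectors of the monomials of the Stanley space `x^a K[W]`. -/
def stanleyInterval {n : ℕ} (a : Fin n → ℕ) (W : Finset (Fin n)) : Set (Fin n → ℕ) :=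
  {c | (∀ i, a i ≤ c i) ∧ ∀ i ∉ W, c i = a i}

/-- The Stanley depth of `J/I` for monomial ideals `I ⊆ J` of `K[x_1,…,x_n]`: the largest
`d` such that the monomials of `J \ I` can be partitioned into finitely many Stanley spaces
`x^a K[W]` with `|W| ≥ d` (by Herzog–Vladoiu–Zheng this agrees with the Stanley depth of the
`ℤⁿ`-graded module `J/I` defined via Stanley decompositions). -/
noncomputable def sdepthQuot {K : Type*} [Field K] {n : ℕ}
    (I J : Ideal (MvPolynomial (Fin n) K)) : ℕ :=
  sSup {d : ℕ | ∃ P : Finset ((Fin n → ℕ) × Finset (Fin n)),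
    (∀ p ∈ P, d ≤ p.2.card) ∧
    ∀ c : Fin n → ℕ, (c ∈ monSet J ∧ c ∉ monSet I) ↔
      ∃! p, p ∈ P ∧ c ∈ stanleyInterval p.1 p.2}


open RingTheory.Sequence CategoryTheory Abelian Pointwise

/-- `R/J` has a regular sequence of length `d` inside `m`. -/
def HasDepth {R : Type*} [CommRing R] (m J : Ideal R) (d : ℕ) : Prop :=
  ∃ rs : List R, rs.length = d ∧ (∀ r ∈ rs, r ∈ m) ∧ IsRegular (R ⧸ J) rs

lemma smul_lt_of_le {R : Type*} [CommRing R] {m J : Ideal R} (hm : m ≠ ⊤) (hJ : J ≤ m) :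
    m • (⊤ : Submodule R (R ⧸ J)) < ⊤ := by
  rw [lt_top_iff_ne_top]
  intro h
  have h1 : m • (⊤ : Submodule R (R ⧸ J)) ≤ Submodule.map (Submodule.mkQ J) m := by
    rw [Submodule.smul_le]
    intro r hr y _
    obtain ⟨s, rfl⟩ := Submodule.mkQ_surjective J y
    exact ⟨r * s, m.mul_mem_right s hr, by simp [← smul_eq_mul]⟩
  rw [h] at h1
  obtain ⟨a, ha, hb⟩ := h1 (Submodule.mem_top : Submodule.mkQ J 1 ∈ _)
  have h2 : a - 1 ∈ J := by
    rw [← Submodule.ker_mkQ J, LinearMap.mem_ker, map_sub, hb, sub_self]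
  apply hm
  rw [Ideal.eq_top_iff_one]
  have := m.sub_mem ha (hJ h2)
  simpa using this

/-- `(R/J)/r(R/J) ≃ R/(J + (r))`. -/
noncomputable def quotSMulTopEquiv {R : Type*} [CommRing R] (J : Ideal R) (r : R) :
    QuotSMulTop r (R ⧸ J) ≃ₗ[R] R ⧸ (J ⊔ Ideal.span {r}) :=
  let φ : (R ⧸ J) →ₗ[R] R ⧸ (J ⊔ Ideal.span {r}) :=
    Submodule.mapQ J (J ⊔ Ideal.span {r}) LinearMap.id (by
      rw [Submodule.comap_id]; exact le_sup_left)
  have hφ : Function.Surjective φ := by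
    intro y
    obtain ⟨s, rfl⟩ := Submodule.mkQ_surjective _ y
    exact ⟨Submodule.mkQ J s, rfl⟩
  have hk : r • (⊤ : Submodule R (R ⧸ J)) = LinearMap.ker φ := by
    ext y
    obtain ⟨s, rfl⟩ := Submodule.mkQ_surjective _ y
    rw [LinearMap.mem_ker]
    have : φ (J.mkQ s) = (J ⊔ Ideal.span {r}).mkQ s := rfl
    rw [this, ← LinearMap.mem_ker, Submodule.ker_mkQ, Submodule.mem_smul_pointwise_iff_exists,
      Submodule.mem_sup]
    constructor
    · rintro ⟨b, _, hb⟩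
      obtain ⟨t, rfl⟩ := Submodule.mkQ_surjective _ b
      refine ⟨s - r * t, ?_, r * t, Ideal.mul_mem_right _ _ (Ideal.subset_span rfl), by ring⟩
      rw [← Submodule.ker_mkQ J, LinearMap.mem_ker, map_sub, ← hb, ← smul_eq_mul, map_smul, sub_self]
    · rintro ⟨j, hj, z, hz, rfl⟩
      obtain ⟨t, rfl⟩ := Ideal.mem_span_singleton'.mp hz
      refine ⟨J.mkQ t, trivial, ?_⟩
      rw [map_add, (LinearMap.mem_ker.mp ((Submodule.ker_mkQ J).symm ▸ hj) : J.mkQ j = 0), zero_add,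
        mul_comm, ← smul_eq_mul, map_smul]
  (Submodule.quotEquivOfEq _ _ hk).trans (φ.quotKerEquivOfSurjective hφ)

lemma HasDepth.zero {R : Type*} [CommRing R] {m J : Ideal R} (hm : m ≠ ⊤) (hJ : J ≤ m) :
    HasDepth m J 0 := by
  refine ⟨[], rfl, by simp, ?_⟩
  have : Nontrivial (R ⧸ J) := Submodule.Quotient.nontrivial_iff.mpr
    (fun h => hm (top_le_iff.mp (h ▸ hJ)))
  exact IsRegular.nil R _

lemma HasDepth.succ {R : Type*} [CommRing R] {m J : Ideal R} {x : R} (hx : x ∈ m)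
    (hreg : ∀ f, x * f ∈ J → f ∈ J) {d : ℕ} (h : HasDepth m (J ⊔ Ideal.span {x}) d) :
    HasDepth m J (d + 1) := by
  obtain ⟨rs, hl, hmem, hr⟩ := h
  refine ⟨x :: rs, by simp [hl], by simpa using ⟨hx, hmem⟩, ?_⟩
  rw [isRegular_cons_iff]
  exact ⟨(isSMulRegular_quotient_iff_mem_of_smul_mem J x).mpr hreg,
    ((quotSMulTopEquiv J x).isRegular_congr rs).mpr hr⟩

universe u

lemma hasDepth_iff {R : Type u} [CommRing R] [IsNoetherianRing R] {m J : Ideal R}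
    (hm : m ≠ ⊤) (hJ : J ≤ m) (d : ℕ) :
    HasDepth m J d ↔ ∀ i < d,
      Subsingleton (Ext (ModuleCat.of R (Shrink.{u} (R ⧸ m))) (ModuleCat.of R (R ⧸ J)) i) := 
  (ModuleCat.exists_isRegular_tfae m d (ModuleCat.of R (R ⧸ J)) (smul_lt_of_le hm hJ)).out 3 1

lemma HasDepth.of_colon {R : Type u} [CommRing R] [IsNoetherianRing R] {m J J' : Ideal R} {x : R}
    (hm : m ≠ ⊤) (hJ : J ≤ m) (hJ' : J' ≤ m) (hx : x ∈ m)
    (hcolon : ∀ f, x * f ∈ J ↔ f ∈ J') {d : ℕ} (h1 : HasDepth m J' d)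
    (h2 : HasDepth m (J ⊔ Ideal.span {x}) d) : HasDepth m J d := by
  have hJx : J ⊔ Ideal.span {x} ≤ m := sup_le hJ ((Ideal.span_singleton_le_iff_mem m).mpr hx)
  rw [hasDepth_iff hm hJ]
  rw [hasDepth_iff hm hJ'] at h1
  rw [hasDepth_iff hm hJx] at h2
  let f : (R ⧸ J') →ₗ[R] (R ⧸ J) := Submodule.mapQ J' J (LinearMap.lsmul R R x)
    (fun y hy => (hcolon y).mpr hy)
  let g : (R ⧸ J) →ₗ[R] R ⧸ (J ⊔ Ideal.span {x}) :=
    Submodule.mapQ J (J ⊔ Ideal.span {x}) LinearMap.id (by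
      rw [Submodule.comap_id]; exact le_sup_left)
  have hf : Function.Injective f := by
    rw [injective_iff_map_eq_zero]
    intro y hy
    obtain ⟨s, rfl⟩ := Submodule.mkQ_surjective _ y
    have hy' : J.mkQ (x * s) = 0 := hy
    rw [← LinearMap.mem_ker, Submodule.ker_mkQ] at hy' ⊢
    exact (hcolon s).mp hy'
  have hg : Function.Surjective g := by
    intro y
    obtain ⟨s, rfl⟩ := Submodule.mkQ_surjective _ y
    exact ⟨Submodule.mkQ J s, rfl⟩
  have hfg : Function.Exact f g := by
    intro y
    obtain ⟨s, rfl⟩ := Submodule.mkQ_surjective _ y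
    have : g (J.mkQ s) = (J ⊔ Ideal.span {x}).mkQ s := rfl
    rw [this, ← LinearMap.mem_ker, Submodule.ker_mkQ, Submodule.mem_sup]
    constructor
    · rintro ⟨j, hj, z, hz, rfl⟩
      obtain ⟨t, rfl⟩ := Ideal.mem_span_singleton'.mp hz
      refine ⟨J'.mkQ t, ?_⟩
      have : f (J'.mkQ t) = J.mkQ (x * t) := rfl
      rw [this, map_add, (LinearMap.mem_ker.mp ((Submodule.ker_mkQ J).symm ▸ hj) : J.mkQ j = 0),
        zero_add, mul_comm]
    · rintro ⟨b, hb⟩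
      obtain ⟨t, rfl⟩ := Submodule.mkQ_surjective _ b
      have : f (J'.mkQ t) = J.mkQ (x * t) := rfl
      rw [this] at hb
      refine ⟨s - x * t, ?_, x * t, Ideal.mul_mem_right _ _ (Ideal.subset_span rfl), by ring⟩
      rw [← Submodule.ker_mkQ J, LinearMap.mem_ker, map_sub, ← hb, sub_self]
  let S := ModuleCat.shortComplexOfCompEqZero f g hfg.linearMap_comp_eq_zero
  have hS : S.ShortExact := ModuleCat.shortComplex_shortExact S hfg hf hg
  intro i hi
  have z1 := AddCommGrpCat.isZero_of_iff_subsingleton.mpr (h1 i hi)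
  have z2 := AddCommGrpCat.isZero_of_iff_subsingleton.mpr (h2 i hi)
  exact AddCommGrpCat.subsingleton_of_isZero <| ShortComplex.Exact.isZero_of_both_zeros
    (Ext.covariant_sequence_exact₂' (ModuleCat.of R (Shrink.{u} (R ⧸ m))) hS i)
    (z1.eq_zero_of_src _) (z2.eq_zero_of_tgt _)

/-- The exponent set generating the edge ideal of `E` plus the variables in `Z`. -/
def genSet {n : ℕ} (E : Fin n → Fin n → Prop) (Z : Set (Fin n)) : Set (Fin n →₀ ℕ) :=
  {s | (∃ z ∈ Z, s = Finsupp.single z 1) ∨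
    ∃ i j, E i j ∧ s = Finsupp.single i 1 + Finsupp.single j 1}

/-- Edge ideal of `E` plus the variables in `Z`. -/
noncomputable def JI (K : Type*) [Field K] {n : ℕ} (E : Fin n → Fin n → Prop) (Z : Set (Fin n)) :
    Ideal (MvPolynomial (Fin n) K) :=
  Ideal.span ((fun s => monomial s (1 : K)) '' genSet E Z)

/-- Exponents of the monomials in `JI`. -/
def Bad {n : ℕ} (E : Fin n → Fin n → Prop) (Z : Set (Fin n)) (m : Fin n →₀ ℕ) : Prop :=
  (∃ z ∈ Z, m z ≠ 0) ∨ ∃ i j, E i j ∧ m i ≠ 0 ∧ m j ≠ 0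

/-- The maximal graded ideal. -/
noncomputable def mm (K : Type*) [Field K] (n : ℕ) : Ideal (MvPolynomial (Fin n) K) :=
  Ideal.span (Set.range (X (R := K) (σ := Fin n)))

section
variable {K : Type u} [Field K] {n : ℕ} {E : Fin n → Fin n → Prop}

lemma mem_JI (hE : ∀ i, ¬ E i i) {Z : Set (Fin n)} {f : MvPolynomial (Fin n) K} :
    f ∈ JI K E Z ↔ ∀ m ∈ f.support, Bad E Z m := by
  rw [JI, mem_ideal_span_monomial_image]
  refine forall₂_congr fun m _ => ?_
  constructor
  · rintro ⟨s, (⟨z, hz, rfl⟩ | ⟨i, j, hij, rfl⟩), hs⟩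
    · left
      refine ⟨z, hz, ?_⟩
      have := hs z
      simp at this; omega
    · right
      refine ⟨i, j, hij, ?_, ?_⟩
      · have := hs i
        simp at this; omega
      · have := hs j
        simp at this; omega
  · rintro (⟨z, hz, h⟩ | ⟨i, j, hij, hi, hj⟩)
    · exact ⟨_, Or.inl ⟨z, hz, rfl⟩, by simpa [Nat.one_le_iff_ne_zero] using h⟩
    · refine ⟨_, Or.inr ⟨i, j, hij, rfl⟩, ?_⟩
      have hne : i ≠ j := fun h => hE i (h ▸ hij)
      intro t
      simp only [Finsupp.add_apply, Finsupp.single_apply]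
      split_ifs with h1 h2 h2
      · exact absurd (h1.trans h2.symm) hne
      · subst h1; omega
      · subst h2; omega
      · omega

lemma mem_mm {f : MvPolynomial (Fin n) K} :
    f ∈ mm K n ↔ ∀ m ∈ f.support, ∃ i, m i ≠ 0 := by
  rw [mm, ← Set.image_univ, mem_ideal_span_X_image]
  simp

lemma mm_ne_top : mm K n ≠ ⊤ := by
  intro h
  have : (1 : MvPolynomial (Fin n) K) ∈ mm K n := h ▸ Submodule.mem_top
  rw [mem_mm] at this
  obtain ⟨i, hi⟩ := this 0 (by simp)
  simp at hi

lemma X_mem_mm (i : Fin n) : (X i : MvPolynomial (Fin n) K) ∈ mm K n :=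
  Ideal.subset_span ⟨i, rfl⟩

lemma JI_le (hE : ∀ i, ¬ E i i) (Z : Set (Fin n)) : JI K E Z ≤ mm K n := by
  intro f hf
  rw [mem_JI hE] at hf
  rw [mem_mm]
  intro m hm
  rcases hf m hm with ⟨z, _, h⟩ | ⟨i, _, _, h, _⟩
  exacts [⟨_, h⟩, ⟨_, h⟩]

lemma X_mul_mem_JI (hE : ∀ i, ¬ E i i) {Z : Set (Fin n)} {x : Fin n} {f : MvPolynomial (Fin n) K} :
    X x * f ∈ JI K E Z ↔ ∀ m ∈ f.support, Bad E Z (Finsupp.single x 1 + m) := by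
  rw [mem_JI hE, support_X_mul]
  simp only [Finset.mem_map, addLeftEmbedding_apply, forall_exists_index, and_imp,
    forall_apply_eq_imp_iff₂]

lemma bad_single_add (hE : ∀ i, ¬ E i i) (hs : ∀ i j, E i j → E j i) {Z : Set (Fin n)} {x : Fin n}
    (hx : x ∉ Z) (m : Fin n →₀ ℕ) :
    Bad E Z (Finsupp.single x 1 + m) ↔ Bad E (Z ∪ {y | E x y}) m := by
  simp only [Bad, Finsupp.add_apply, Finsupp.single_apply]
  constructor
  · rintro (⟨z, hz, h⟩ | ⟨i, j, hij, hi, hj⟩)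
    · rw [if_neg (fun h' => hx (by rw [h']; exact hz))] at h
      exact Or.inl ⟨z, Or.inl hz, by omega⟩
    · by_cases h1 : x = i
      · subst h1
        have : x ≠ j := fun h => hE x (h ▸ hij)
        rw [if_neg this] at hj
        exact Or.inl ⟨j, Or.inr hij, by omega⟩
      · rw [if_neg h1] at hi
        by_cases h2 : x = j
        · subst h2
          exact Or.inl ⟨i, Or.inr (hs _ _ hij), by omega⟩
        · rw [if_neg h2] at hj
          exact Or.inr ⟨i, j, hij, by omega, by omega⟩
  · rintro (⟨z, hz | hz, h⟩ | ⟨i, j, hij, hi, hj⟩)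
    · exact Or.inl ⟨z, hz, by omega⟩
    · exact Or.inr ⟨x, z, hz, by simp, by omega⟩
    · exact Or.inr ⟨i, j, hij, by omega, by omega⟩

lemma JI_sup (Z : Set (Fin n)) (x : Fin n) :
    JI K E Z ⊔ Ideal.span {X x} = JI K E (insert x Z) := by
  rw [JI, JI, ← Ideal.span_union]
  congr 1
  ext f
  constructor
  · rintro (⟨s, (⟨z, hz, rfl⟩ | h), rfl⟩ | rfl)
    · exact ⟨_, Or.inl ⟨z, Or.inr hz, rfl⟩, rfl⟩
    · exact ⟨_, Or.inr h, rfl⟩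
    · exact ⟨_, Or.inl ⟨x, Or.inl rfl, rfl⟩, rfl⟩
  · rintro ⟨s, (⟨z, rfl | hz, rfl⟩ | h), rfl⟩
    · exact Or.inr rfl
    · exact Or.inl ⟨_, Or.inl ⟨z, hz, rfl⟩, rfl⟩
    · exact Or.inl ⟨_, Or.inr h, rfl⟩

/-- `W` is the set of surviving vertices. -/
def Q (K : Type u) [Field K] {n : ℕ} (E : Fin n → Fin n → Prop) (W : Finset (Fin n)) (d : ℕ) :
    Prop := HasDepth (mm K n) (JI K E {i | i ∉ W}) d

lemma Q_zero (hE : ∀ i, ¬ E i i) (W : Finset (Fin n)) : Q K E W 0 :=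
  HasDepth.zero mm_ne_top (JI_le hE _)

lemma Q_isolated (hE : ∀ i, ¬ E i i) (hs : ∀ i j, E i j → E j i) {W : Finset (Fin n)} {d : ℕ}
    {x : Fin n} (hx : x ∈ W) (hN : ∀ y ∈ W, ¬ E x y) (h : Q K E (W.erase x) d) :
    Q K E W (d + 1) := by
  refine HasDepth.succ (X_mem_mm x) ?_ (d := d) ?_
  · intro f hf
    rw [X_mul_mem_JI hE] at hf
    rw [mem_JI hE]
    intro m hm
    have := hf m hm
    rw [bad_single_add hE hs (by simpa using hx)] at this
    have h2 : ({i | i ∉ W} ∪ {y | E x y} : Set (Fin n)) = {i | i ∉ W} := by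
      ext y
      simp only [Set.mem_union, Set.mem_ofPred_eq]
      exact ⟨fun h => h.elim id (fun h1 h2 => hN y h2 h1), Or.inl⟩
    rwa [h2] at this
  · rw [JI_sup]
    unfold Q at h
    convert h using 2
    ext y
    simp only [Set.mem_insert_iff, Set.mem_ofPred_eq, Finset.mem_erase]
    tauto

open Classical in
lemma Q_step (hE : ∀ i, ¬ E i i) (hs : ∀ i j, E i j → E j i) {W : Finset (Fin n)} {d : ℕ}
    {x : Fin n} (hx : x ∈ W) (h1 : Q K E (W.filter (fun y => y ≠ x ∧ ¬ E x y)) d)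
    (h2 : Q K E (W.erase x) (d + 1)) : Q K E W (d + 1) := by
  refine HasDepth.of_colon (J' := JI K E ({i | i ∉ W} ∪ {y | E x y})) mm_ne_top (JI_le hE _)
    (JI_le hE _) (X_mem_mm x) ?_ ?_ ?_
  · intro f
    rw [X_mul_mem_JI hE, mem_JI hE]
    exact forall₂_congr fun m _ => bad_single_add hE hs (by simpa using hx) m
  · have : Q K E (W.filter (fun y => ¬ E x y)) (d + 1) := by
      refine Q_isolated hE hs (x := x) (by simp [hx, hE]) (by simp) ?_
      convert h1 using 1
      ext y
      simp; tauto
    unfold Q at this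
    convert this using 2
    ext y
    simp; tauto
  · rw [JI_sup]
    unfold Q at h2
    convert h2 using 2
    ext y
    simp only [Set.mem_insert_iff, Set.mem_ofPred_eq, Finset.mem_erase]
    tauto

open Classical in
lemma Q_packing (hE : ∀ i, ¬ E i i) (hs : ∀ i j, E i j → E j i) (W C : Finset (Fin n))
    (hC : C ⊆ W)
    (hd : ∀ c ∈ C, ∀ c' ∈ C, c ≠ c' → ∀ v ∈ W, ¬ ((v = c ∨ E c v) ∧ (v = c' ∨ E c' v))) :
    Q K E W C.card := by
  induction hW : W.card using Nat.strong_induction_on generalizing W C with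
  | _ N ih =>
  rcases C.eq_empty_or_nonempty with rfl | ⟨c, hc⟩
  · exact Q_zero hE W
  have hcW := hC hc
  have hcard : C.card = (C.erase c).card + 1 := (Finset.card_erase_add_one hc).symm
  rw [hcard]
  have hlt : ∀ y ∈ W, (W.erase y).card < N := fun y hy => hW ▸ Finset.card_erase_lt_of_mem hy
  by_cases hN : ∀ y ∈ W, ¬ E c y
  · refine Q_isolated hE hs hcW hN (ih _ (hlt c hcW) _ _ (Finset.erase_subset_erase _ hC) ?_ rfl)
    intro a ha b hb hab v hv
    exact hd a (Finset.mem_of_mem_erase ha) b (Finset.mem_of_mem_erase hb) hab v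
      (Finset.mem_of_mem_erase hv)
  · push Not at hN
    obtain ⟨x, hxW, hcx⟩ := hN
    have hxc : x ≠ c := fun h => hE c (h ▸ hcx)
    have key : ∀ c' ∈ C, c' ≠ c → ¬ (x = c' ∨ E c' x) := fun c' hc' hne h =>
      hd c hc c' hc' hne.symm x hxW ⟨Or.inr hcx, h⟩
    refine Q_step hE hs hxW ?_ ?_
    · refine ih _ ?_ _ _ ?_ ?_ rfl
      · refine lt_of_le_of_lt (Finset.card_le_card ?_) (hlt x hxW)
        intro y hy
        simp at hy ⊢; tauto
      · intro c' hc'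
        rw [Finset.mem_erase] at hc'
        have := key c' hc'.2 hc'.1
        rw [Finset.mem_filter]
        refine ⟨hC hc'.2, fun h => this (Or.inl h.symm), fun h => this (Or.inr (hs _ _ h))⟩
      · intro a ha b hb hab v hv
        exact hd a (Finset.mem_of_mem_erase ha) b (Finset.mem_of_mem_erase hb) hab v
          (Finset.mem_filter.mp hv).1
    · rw [← hcard]
      refine ih _ (hlt x hxW) _ _ ?_ ?_ rfl
      · intro c' hc'
        rw [Finset.mem_erase]
        refine ⟨fun h => ?_, hC hc'⟩
        by_cases h2 : c' = c
        · exact hxc (h ▸ h2)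
        · exact key c' hc' h2 (Or.inl h.symm)
      · intro a ha b hb hab v hv
        exact hd a ha b hb hab v (Finset.mem_of_mem_erase hv)

/-- Adjacency in the `k`-th power of the `n`-cycle. -/
def CE (n k : ℕ) (i j : Fin n) : Prop :=
  ((i : ℕ) < j ∧ ((j : ℕ) - i ≤ k ∨ n - k ≤ (j : ℕ) - i)) ∨
  ((j : ℕ) < i ∧ ((i : ℕ) - j ≤ k ∨ n - k ≤ (i : ℕ) - j))

lemma CE_irrefl (k : ℕ) (i : Fin n) : ¬ CE n k i i := by simp [CE]

lemma CE_symm (k : ℕ) (i j : Fin n) (h : CE n k i j) : CE n k j i := Or.symm h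

lemma cycleIdeal_eq (k : ℕ) : cycleIdeal K n k = JI K (CE n k) {i | i ∉ Finset.univ} := by
  unfold cycleIdeal JI
  congr 1
  have hX : ∀ i j : Fin n, (monomial (Finsupp.single i 1 + Finsupp.single j 1) (1 : K)) =
      X i * X j := by
    intro i j
    simp [X, monomial_mul]
  ext f
  constructor
  · rintro ⟨i, j, h1, h2, rfl⟩
    exact ⟨_, Or.inr ⟨i, j, Or.inl ⟨h1, h2⟩, rfl⟩, hX i j⟩
  · rintro ⟨s, (⟨z, hz, rfl⟩ | ⟨i, j, h | h, rfl⟩), rfl⟩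
    · simp at hz
    · exact ⟨i, j, h.1, h.2, hX i j⟩
    · exact ⟨j, i, h.1, h.2, (hX i j).trans (mul_comm _ _)⟩

/-- Packing in an interval `[a, b)` of length at most `n - k`. -/
lemma Q_interval (k d a b : ℕ) (hb : b ≤ n) (hab : b ≤ a + (n - k)) (W : Finset (Fin n))
    (hW : ∀ i, i ∈ W ↔ a ≤ (i : ℕ) ∧ (i : ℕ) < b)
    (hlen : ∀ t < d, a + t * (2 * k + 1) < b) : Q K (CE n k) W d := by
  classical
  let g : Fin d ↪ Fin n := ⟨fun t => ⟨a + t * (2 * k + 1), (hlen t t.2).trans_le hb⟩, by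
    intro t s h
    simp only [Fin.mk.injEq, add_right_inj] at h
    exact Fin.ext (Nat.eq_of_mul_eq_mul_right (by omega) h)⟩
  have hmain := Q_packing (K := K) (CE_irrefl k) (CE_symm k) W (Finset.univ.map g) ?_ ?_
  · simpa using hmain
  · intro c hc
    obtain ⟨t, _, rfl⟩ := Finset.mem_map.mp hc
    rw [hW]
    exact ⟨Nat.le_add_right _ _, hlen t t.2⟩
  · intro c hc c' hc' hne v hv
    obtain ⟨t, _, rfl⟩ := Finset.mem_map.mp hc
    obtain ⟨s, _, rfl⟩ := Finset.mem_map.mp hc'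
    have hts : (t : ℕ) ≠ s := fun h => hne (by rw [Fin.ext h])
    rw [hW] at hv
    have ht := hlen t t.2
    have hs := hlen s s.2
    have hgt : ((g t : Fin n) : ℕ) = a + t * (2 * k + 1) := rfl
    have hgs : ((g s : Fin n) : ℕ) = a + s * (2 * k + 1) := rfl
    have hfar : (t : ℕ) * (2 * k + 1) + (2 * k + 1) ≤ s * (2 * k + 1) ∨
        (s : ℕ) * (2 * k + 1) + (2 * k + 1) ≤ t * (2 * k + 1) := by
      rcases Nat.lt_or_gt_of_ne hts with h | h
      · left
        have := Nat.mul_le_mul_right (2 * k + 1) (Nat.succ_le_of_lt h)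
        rwa [Nat.succ_mul] at this
      · right
        have := Nat.mul_le_mul_right (2 * k + 1) (Nat.succ_le_of_lt h)
        rwa [Nat.succ_mul] at this
    rw [← hgt] at ht
    rw [← hgs] at hs
    simp only [CE, Fin.ext_iff]
    generalize (t : ℕ) * (2 * k + 1) = T at *
    generalize (s : ℕ) * (2 * k + 1) = T' at *
    omega

lemma Q_cycle (k : ℕ) (hn : 2 * k + 2 ≤ n) : Q K (CE n k) Finset.univ ((n + k) / (2 * k + 1)) := by
  classical
  obtain ⟨d, hd⟩ : ∃ d, (n + k) / (2 * k + 1) = d + 1 :=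
    Nat.exists_eq_succ_of_ne_zero (Nat.div_pos (by omega) (by omega)).ne'
  have hle : d * (2 * k + 1) + (2 * k + 1) ≤ n + k := by
    have := Nat.div_mul_le_self (n + k) (2 * k + 1)
    rwa [hd, Nat.succ_mul] at this
  rw [hd]
  have main : ∀ j ≤ k, Q K (CE n k) (Finset.univ.filter (fun i : Fin n => (i : ℕ) < n - (k - j)))
      (d + 1) := by
    intro j
    induction j with
    | zero =>
      intro _
      refine Q_interval k (d + 1) 0 (n - k) (by omega) (by omega) _ (by simp) ?_
      intro t ht
      have := Nat.mul_le_mul_right (2 * k + 1) (Nat.le_of_lt_succ ht)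
      omega
    | succ j ih =>
      intro hj
      have hx : n - (k - j) < n := by omega
      refine Q_step (CE_irrefl k) (CE_symm k) (x := ⟨n - (k - j), hx⟩) (by simp; omega) ?_ ?_
      · refine Q_interval k d (j + 1) (n - (k - j) - k) (by omega) (by omega) _ ?_ ?_
        · intro i
          have := i.2
          simp only [Finset.mem_filter, Finset.mem_univ, true_and, CE, ne_eq, Fin.ext_iff]
          omega
        · intro t ht
          have := Nat.mul_le_mul_right (2 * k + 1) (Nat.succ_le_of_lt ht)
          rw [Nat.succ_mul] at this
          omega
      · convert ih (by omega) using 1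
        ext i
        simp only [Finset.mem_erase, Finset.mem_filter, Finset.mem_univ, true_and, ne_eq,
          Fin.ext_iff]
        omega
  convert main k le_rfl using 1
  ext i
  simp

lemma le_pdepth_of_Q {k d : ℕ} (h : Q K (CE n k) Finset.univ d) :
    (d : ℕ∞) ≤ pdepth (cycleIdeal K n k) := by
  unfold Q at h
  rw [← cycleIdeal_eq] at h
  obtain ⟨rs, hl, hmem, hr⟩ := h
  exact le_sSup ⟨rs, hmem, hr.toIsWeaklyRegular, by rw [hl]⟩

lemma one_le_pdepth (k : ℕ) (hn : 0 < n) : 1 ≤ pdepth (cycleIdeal K n k) := by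
  classical
  refine le_pdepth_of_Q (d := 1) ?_
  have := Q_packing (K := K) (CE_irrefl k) (CE_symm k) Finset.univ {(⟨0, hn⟩ : Fin n)} (by simp)
    (by intro c hc c' hc' h; simp at hc hc'; exact absurd (hc.trans hc'.symm) h)
  simpa using this
end

/-- Restriction to the `a`-axis. -/
noncomputable def axis (K : Type*) [Field K] {n : ℕ} (a : Fin n) :
    MvPolynomial (Fin n) K →ₐ[K] MvPolynomial (Fin n) K :=
  aeval (fun i => if i = a then X a else 0)

section
variable {K : Type u} [Field K] {n : ℕ}

lemma axis_X_self (a : Fin n) : axis K a (X a) = X a := by simp [axis]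

lemma axis_X_ne {a i : Fin n} (h : i ≠ a) : axis K a (X i) = 0 := by simp [axis, h]

lemma axis_axis (a : Fin n) (f : MvPolynomial (Fin n) K) : axis K a (axis K a f) = axis K a f := by
  have : (axis K a).comp (axis K a) = axis K a := by
    ext1 i
    by_cases h : i = a
    · subst h; simp [axis_X_self]
    · simp [axis_X_ne h]
  exact DFunLike.congr_fun this f

lemma constantCoeff_axis (a : Fin n) (f : MvPolynomial (Fin n) K) :
    constantCoeff (axis K a f) = constantCoeff f := by
  have : constantCoeff.comp (axis K a).toRingHom =
      (constantCoeff : MvPolynomial (Fin n) K →+* K) := by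
    apply MvPolynomial.ringHom_ext
    · intro r
      simp [axis]
    · intro i
      by_cases h : i = a
      · subst h; simp [axis_X_self]
      · simp [axis_X_ne h]
  exact DFunLike.congr_fun this f

lemma axis_mem_span (a : Fin n) {f : MvPolynomial (Fin n) K} (hf : f ∈ mm K n) :
    axis K a f ∈ Ideal.span {(X a : MvPolynomial (Fin n) K)} := by
  have h : mm K n ≤ (Ideal.span {(X a : MvPolynomial (Fin n) K)}).comap (axis K a) := by
    rw [mm, Ideal.span_le]
    rintro _ ⟨i, rfl⟩
    change axis K a (X i) ∈ Ideal.span {(X a : MvPolynomial (Fin n) K)}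
    by_cases h : i = a
    · subst h; rw [axis_X_self]; exact Ideal.subset_span rfl
    · rw [axis_X_ne h]; exact zero_mem _
  exact h hf

lemma X_mul_axis_sub (a : Fin n) {I : Ideal (MvPolynomial (Fin n) K)}
    (hI : ∀ i j, i ≠ j → X i * X j ∈ I) (f : MvPolynomial (Fin n) K) :
    X a * (axis K a f - f) ∈ I := by
  induction f using MvPolynomial.induction_on with
  | C r => simp [axis]
  | add p q hp hq =>
    rw [map_add]
    convert I.add_mem hp hq using 1
    ring
  | mul_X p i hp =>
    rw [map_mul]
    by_cases h : i = a
    · subst h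
      rw [axis_X_self]
      convert I.mul_mem_right (X i) hp using 1
      ring
    · rw [axis_X_ne h]
      convert I.mul_mem_right (-p) (hI a i (Ne.symm h)) using 1
      ring

lemma not_regular_pair {I : Ideal (MvPolynomial (Fin n) K)}
    (hI : ∀ i j, i ≠ j → X i * X j ∈ I) (hX : ∀ i, X i ∉ I)
    (hker : ∀ a, ∀ f ∈ I, axis K a f = 0) {a b : Fin n} (hab : a ≠ b)
    {r s : MvPolynomial (Fin n) K} (hr : r ∈ mm K n) (hs : s ∈ mm K n)
    (h1 : ∀ f, r * f ∈ I → f ∈ I)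
    (h2 : ∀ f, s * f ∈ I ⊔ Ideal.span {r} → f ∈ I ⊔ Ideal.span {r}) : False := by
  have hne : ∀ c, axis K c r ≠ 0 := by
    intro c h
    have h3 := X_mul_axis_sub c hI r
    rw [h, zero_sub, mul_neg, neg_mem_iff, mul_comm] at h3
    exact hX c (h1 _ h3)
  obtain ⟨p, hp⟩ := Ideal.mem_span_singleton'.mp (axis_mem_span a hr)
  have hkill : ∀ i, X i * axis K a r ∈ I ⊔ Ideal.span {r} := by
    intro i
    by_cases h : i = a
    · subst h
      have h3 := X_mul_axis_sub i hI r
      have h4 : X i * r ∈ Ideal.span {r} := Ideal.mul_mem_left _ _ (Ideal.subset_span rfl)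
      have := add_mem (Ideal.mem_sup_left h3 : _ ∈ I ⊔ Ideal.span {r}) (Ideal.mem_sup_right h4)
      convert this using 1
      ring
    · apply Ideal.mem_sup_left
      rw [← hp]
      convert I.mul_mem_left p (hI i a h) using 1
      ring
  have hs' : s * axis K a r ∈ I ⊔ Ideal.span {r} := by
    have : mm K n ≤ (I ⊔ Ideal.span {r}).colon {axis K a r} := by
      rw [mm, Ideal.span_le]
      rintro _ ⟨i, rfl⟩
      exact Submodule.mem_colon_singleton.mpr (hkill i)
    exact Submodule.mem_colon_singleton.mp (this hs)
  obtain ⟨u, hu, v, hv, huv⟩ := Submodule.mem_sup.mp (h2 _ hs')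
  obtain ⟨g, rfl⟩ := Ideal.mem_span_singleton'.mp hv
  have ga : axis K a g = 1 := by
    have := congrArg (axis K a) huv
    rw [map_add, map_mul, hker a u hu, axis_axis, zero_add] at this
    exact mul_right_cancel₀ (hne a) (by rw [this, one_mul])
  have gb : axis K b g = 0 := by
    have := congrArg (axis K b) huv
    rw [map_add, map_mul, hker b u hu, ← hp, map_mul, axis_X_ne hab, mul_zero, zero_add] at this
    exact (mul_eq_zero.mp this).resolve_right (hne b)
  have e1 := constantCoeff_axis a g
  have e2 := constantCoeff_axis b g
  rw [ga, map_one] at e1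
  rw [gb, map_zero] at e2
  exact one_ne_zero (e1.trans e2.symm)

lemma pdepth_le_one (k : ℕ) (hn : 2 ≤ n) (hk : n ≤ 2 * k + 1) :
    pdepth (cycleIdeal K n k) ≤ 1 := by
  refine sSup_le ?_
  rintro _ ⟨rs, hmem, hr, rfl⟩
  match rs with
  | [] => simp
  | [_] => simp
  | r :: s :: rest =>
    exfalso
    rw [isWeaklyRegular_cons_iff, isWeaklyRegular_cons_iff] at hr
    obtain ⟨h1, h2, _⟩ := hr
    rw [isSMulRegular_quotient_iff_mem_of_smul_mem] at h1
    rw [(quotSMulTopEquiv _ r).isSMulRegular_congr,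
      isSMulRegular_quotient_iff_mem_of_smul_mem] at h2
    refine not_regular_pair (I := cycleIdeal K n k) (a := ⟨0, by omega⟩) (b := ⟨1, by omega⟩)
      ?_ ?_ ?_ (by simp) (hmem r (by simp)) (hmem s (by simp)) h1 h2
    · intro i j hij
      have hij' : (i : ℕ) ≠ j := fun h => hij (Fin.ext h)
      rcases Nat.lt_or_gt_of_ne hij' with h | h
      · exact Ideal.subset_span ⟨i, j, h, by omega, rfl⟩
      · exact Ideal.subset_span ⟨j, i, h, by omega, mul_comm _ _⟩
    · intro i hi
      rw [cycleIdeal_eq, mem_JI (CE_irrefl k)] at hi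
      rcases hi (Finsupp.single i 1) (by simp [X]) with ⟨z, hz, _⟩ | ⟨p, q, hpq, hp, hq⟩
      · simp at hz
      · rw [Finsupp.single_apply_ne_zero] at hp hq
        rw [hp.1, hq.1] at hpq
        exact CE_irrefl k i hpq
    · intro a f hf
      have : cycleIdeal K n k ≤ RingHom.ker (axis K a) := by
        refine Ideal.span_le.mpr ?_
        rintro _ ⟨i, j, h, _, rfl⟩
        change axis K a (X i * X j) = 0
        rw [map_mul]
        by_cases hi : i = a
        · rw [axis_X_ne (i := j) (by rintro rfl; subst hi; exact absurd h (lt_irrefl _)), mul_zero]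
        · rw [axis_X_ne hi, zero_mul]
      exact this hf
end

theorem stmt14 (K : Type*) [Field K] (n k : ℕ) (hn : 3 ≤ n) (hk : 1 ≤ k) :
    (n ≤ 2 * k + 1 → pdepth (cycleIdeal K n k) = 1) ∧
    (2 * k + 2 ≤ n → pdepth (cycleIdeal K n k) ≥ (((n + k) / (2 * k + 1) : ℕ) : ℕ∞)) := by
  exact ⟨fun h => le_antisymm (pdepth_le_one k (by omega) h) (one_le_pdepth k (by omega)),
    fun h => le_pdepth_of_Q (Q_cycle k h)⟩
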